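/- arXiv:1901.04131 — 6 statements merged into one kernel-verified Lean document; each statement's English description precedes it below -/
import Mathlib

section
/- (Choi) Let n ≥ 1 and let B₁, B₂, B₀ ∈ M_n(ℂ) be Hermitian matrices such that B₁ and B₂ are positive semidefinite and B₁ + d·B₀ + d²·B₂ is positive semidefinite for every d ∈ ℝ. Then for every k ≥ 1 and all matrices C₁, C₂, D ∈ M_k(ℂ) with C₁, C₂ positive semidefinite, D Hermitian, and the 2k×2k block matrix [[C₁, D],[D, C₂]] positive semidefinite, the matrix C₁ ⊗ B₁ + D ⊗ B₀ + C₂ ⊗ B₂ is positive semidefinite. (Equivalently: every positive linear map from the operator system of symmetric matrices span{E₁₁, E₂₂, E₁₂+E₂₁} ⊆ M₂(ℂ) into M_n(ℂ) is completely positive.) -/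
open Matrix
open scoped Kronecker ComplexOrder

section MatrixCStar

open scoped MatrixOrder Matrix.Norms.L2Operator

theorem Matrix.PosDef.exists_isUnit_eq_mul_conjTranspose {m : Type*} [Fintype m] [DecidableEq m]
    {C : Matrix m m ℂ} (hC : C.PosDef) : ∃ b : Matrix m m ℂ, IsUnit b ∧ C = b * bᴴ :=
  CStarAlgebra.isStrictlyPositive_iff_eq_mul_star_self.mp hC.isStrictlyPositive

end MatrixCStar

/-- A positive definite matrix and a Hermitian matrix are simultaneously diagonalizable by
congruence. -/
theorem Matrix.PosDef.exists_simultaneous_diagonalization {m : Type*} [Fintype m] [DecidableEq m]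
    {C D : Matrix m m ℂ} (hC : C.PosDef) (hD : D.IsHermitian) :
    ∃ (Q : Matrix m m ℂ) (d : m → ℝ), IsUnit Q ∧ C = Q * Qᴴ ∧
      D = Q * diagonal (fun i => (d i : ℂ)) * Qᴴ := by
  obtain ⟨b, hb, rfl⟩ := hC.exists_isUnit_eq_mul_conjTranspose
  have hbdet : IsUnit b.det := (Matrix.isUnit_iff_isUnit_det b).mp hb
  have hH : (b⁻¹ * D * b⁻¹ᴴ).IsHermitian := isHermitian_mul_mul_conjTranspose _ hD
  have hU : (hH.eigenvectorUnitary : Matrix m m ℂ) * (hH.eigenvectorUnitary : Matrix m m ℂ)ᴴ = 1 :=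
    Unitary.coe_mul_star_self hH.eigenvectorUnitary
  have hspec : b⁻¹ * D * b⁻¹ᴴ = (hH.eigenvectorUnitary : Matrix m m ℂ) *
      diagonal (fun i => (hH.eigenvalues i : ℂ)) * (hH.eigenvectorUnitary : Matrix m m ℂ)ᴴ :=
    hH.spectral_theorem
  generalize (hH.eigenvectorUnitary : Matrix m m ℂ) = U at hU hspec
  generalize hH.eigenvalues = d at hspec
  refine ⟨b * U, d, hb.mul (IsUnit.of_mul_eq_one _ hU), ?_, ?_⟩
  · rw [conjTranspose_mul, Matrix.mul_assoc, ← Matrix.mul_assoc U, hU, Matrix.one_mul]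
  · have hinv : b⁻¹ᴴ * bᴴ = 1 := by
      rw [← conjTranspose_mul, Matrix.mul_nonsing_inv _ hbdet, conjTranspose_one]
    calc D = (b * b⁻¹) * D * (b⁻¹ᴴ * bᴴ) := by
          rw [hinv, Matrix.mul_nonsing_inv _ hbdet, Matrix.one_mul, Matrix.mul_one]
      _ = b * (b⁻¹ * D * b⁻¹ᴴ) * bᴴ := by simp only [Matrix.mul_assoc]
      _ = _ := by rw [hspec, conjTranspose_mul]; simp only [Matrix.mul_assoc]

section QuadraticPencil

variable {m n : Type*} [Fintype m] [DecidableEq m] [Fintype n] {B₁ B₂ B₀ : Matrix n n ℂ}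

theorem Matrix.posSemidef_diagonal_pencil
    (hd : ∀ d : ℝ, (B₁ + (d : ℂ) • B₀ + ((d : ℂ) ^ 2) • B₂).PosSemidef) (d : m → ℝ) :
    ((1 : Matrix m m ℂ) ⊗ₖ B₁ + diagonal (fun i => (d i : ℂ)) ⊗ₖ B₀ +
      diagonal (fun i => (d i : ℂ) ^ 2) ⊗ₖ B₂).PosSemidef := by
  have h : (1 : Matrix m m ℂ) ⊗ₖ B₁ + diagonal (fun i => (d i : ℂ)) ⊗ₖ B₀ +
      diagonal (fun i => (d i : ℂ) ^ 2) ⊗ₖ B₂ =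
      ∑ i, diagonal (Pi.single i (1 : ℂ)) ⊗ₖ (B₁ + (d i : ℂ) • B₀ + ((d i : ℂ) ^ 2) • B₂) := by
    ext ⟨i, a⟩ ⟨j, b⟩
    by_cases hij : i = j
    · subst hij
      simp [Matrix.sum_apply, Pi.single_apply]
    · simp [Matrix.sum_apply, hij]
  rw [h]
  refine posSemidef_sum _ fun i _ => PosSemidef.kronecker (PosSemidef.diagonal ?_) (hd _)
  exact Pi.single_nonneg.mpr zero_le_one

theorem Matrix.PosDef.posSemidef_pencil (hp2 : B₂.PosSemidef)
    (hd : ∀ d : ℝ, (B₁ + (d : ℂ) • B₀ + ((d : ℂ) ^ 2) • B₂).PosSemidef)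
    {C₁ C₂ D : Matrix m m ℂ} (hC₁ : C₁.PosDef) (hD : D.IsHermitian)
    (hC : (fromBlocks C₁ D D C₂).PosSemidef) :
    (C₁ ⊗ₖ B₁ + D ⊗ₖ B₀ + C₂ ⊗ₖ B₂).PosSemidef := by
  classical
  have := hC₁.isUnit.invertible
  have hS : (C₂ - D * C₁⁻¹ * D).PosSemidef := by
    have := PosDef.fromBlocks₁₁ D C₂ hC₁
    rw [hD.eq] at this
    exact this.mp hC
  obtain ⟨Q, d, hQ, h₁, h₀⟩ := hC₁.exists_simultaneous_diagonalization hD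
  have hQdet : IsUnit Q.det := (Matrix.isUnit_iff_isUnit_det Q).mp hQ
  have hQdet' : IsUnit Qᴴ.det := by rw [det_conjTranspose]; exact hQdet.star
  have hDD : D * C₁⁻¹ * D = Q * diagonal (fun i => (d i : ℂ) ^ 2) * Qᴴ := by
    calc D * C₁⁻¹ * D = Q * diagonal (fun i => (d i : ℂ)) * (Qᴴ * Qᴴ⁻¹) * (Q⁻¹ * Q) *
          diagonal (fun i => (d i : ℂ)) * Qᴴ := by
          rw [h₀, h₁, Matrix.mul_inv_rev]; simp only [Matrix.mul_assoc]
      _ = Q * (diagonal (fun i => (d i : ℂ)) * diagonal (fun i => (d i : ℂ))) * Qᴴ := by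
          rw [Matrix.mul_nonsing_inv _ hQdet', Matrix.nonsing_inv_mul _ hQdet]
          simp only [Matrix.mul_assoc, Matrix.one_mul]
      _ = _ := by simp only [diagonal_mul_diagonal, sq]
  have hkron : ∀ (X : Matrix m m ℂ) (B : Matrix n n ℂ),
      (Q * X * Qᴴ) ⊗ₖ B = (Q ⊗ₖ (1 : Matrix n n ℂ)) * (X ⊗ₖ B) * (Q ⊗ₖ (1 : Matrix n n ℂ))ᴴ := by
    intro X B
    rw [conjTranspose_kronecker, ← mul_kronecker_mul, ← mul_kronecker_mul, conjTranspose_one,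
      Matrix.one_mul, Matrix.mul_one]
  have key : C₁ ⊗ₖ B₁ + D ⊗ₖ B₀ + C₂ ⊗ₖ B₂ =
      (Q ⊗ₖ (1 : Matrix n n ℂ)) * ((1 : Matrix m m ℂ) ⊗ₖ B₁ +
        diagonal (fun i => (d i : ℂ)) ⊗ₖ B₀ + diagonal (fun i => (d i : ℂ) ^ 2) ⊗ₖ B₂) *
        (Q ⊗ₖ (1 : Matrix n n ℂ))ᴴ + (C₂ - D * C₁⁻¹ * D) ⊗ₖ B₂ := by
    rw [Matrix.mul_add, Matrix.mul_add, Matrix.add_mul, Matrix.add_mul, ← hkron, ← hkron, ← hkron,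
      ← hDD, Matrix.mul_one, ← h₁, ← h₀, add_assoc _ (_ ⊗ₖ B₂), ← add_kronecker,
      add_sub_cancel]
  rw [key]
  exact ((posSemidef_diagonal_pencil hd d).mul_mul_conjTranspose_same _).add
    (hS.kronecker hp2)

end QuadraticPencil

theorem Matrix.posSemidef_of_forall_pos_add_smul {m : Type*} [Fintype m] {A P : Matrix m m ℂ}
    (hA : A.IsHermitian) (h : ∀ ε : ℝ, 0 < ε → (A + (ε : ℂ) • P).PosSemidef) : A.PosSemidef := by
  refine .of_dotProduct_mulVec_nonneg hA fun x => ?_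
  have hlim : Filter.Tendsto
      (fun ε : ℝ => star x ⬝ᵥ (A *ᵥ x) + (ε : ℂ) * (star x ⬝ᵥ (P *ᵥ x)))
      (nhdsWithin 0 (Set.Ioi 0)) (nhds (star x ⬝ᵥ (A *ᵥ x))) := by
    have hcont : Continuous
        (fun ε : ℝ => star x ⬝ᵥ (A *ᵥ x) + (ε : ℂ) * (star x ⬝ᵥ (P *ᵥ x))) := by fun_prop
    simpa using (hcont.tendsto 0).mono_left nhdsWithin_le_nhds
  refine ge_of_tendsto hlim ?_
  filter_upwards [self_mem_nhdsWithin] with ε hε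
  simpa [add_mulVec, smul_mulVec, dotProduct_add] using (h ε hε).dotProduct_mulVec_nonneg x

/-- (Choi) Let `B₁, B₂, B₀ ∈ M_n(ℂ)` be Hermitian with `B₁, B₂` positive semidefinite and
`B₁ + d·B₀ + d²·B₂` positive semidefinite for every real `d`. Then for every `k ≥ 1` and
all `C₁, C₂, D ∈ M_k(ℂ)` with `C₁, C₂` positive semidefinite, `D` Hermitian and the block
matrix `[[C₁, D], [D, C₂]]` positive semidefinite, the matrix
`C₁ ⊗ B₁ + D ⊗ B₀ + C₂ ⊗ B₂` is positive semidefinite. (Equivalently: every positive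
linear map from the operator system of symmetric matrices
`span{E₁₁, E₂₂, E₁₂+E₂₁} ⊆ M₂(ℂ)` into `M_n(ℂ)` is completely positive.) -/
theorem choi_symmetric_positive_is_completely_positive {n : ℕ} (hn : 1 ≤ n)
    (B₁ B₂ B₀ : Matrix (Fin n) (Fin n) ℂ)
    (h1 : B₁.IsHermitian) (h2 : B₂.IsHermitian) (h0 : B₀.IsHermitian)
    (hp1 : B₁.PosSemidef) (hp2 : B₂.PosSemidef)
    (hd : ∀ d : ℝ, (B₁ + (d : ℂ) • B₀ + ((d : ℂ) ^ 2) • B₂).PosSemidef) :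
    ∀ (k : ℕ), 1 ≤ k → ∀ C₁ C₂ D : Matrix (Fin k) (Fin k) ℂ,
      C₁.PosSemidef → C₂.PosSemidef → D.IsHermitian →
      (Matrix.fromBlocks C₁ D D C₂).PosSemidef →
      (C₁ ⊗ₖ B₁ + D ⊗ₖ B₀ + C₂ ⊗ₖ B₂).PosSemidef := by
  intro k _ C₁ C₂ D hC₁ hC₂ hD hC
  refine posSemidef_of_forall_pos_add_smul (P := (1 : Matrix (Fin k) (Fin k) ℂ) ⊗ₖ B₁) ?_
    fun ε hε => ?_
  · simp only [IsHermitian, conjTranspose_add, conjTranspose_kronecker, hC₁.isHermitian.eq,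
      hC₂.isHermitian.eq, hD.eq, h1.eq, h2.eq, h0.eq]
  · have hε' : (0 : ℂ) < (ε : ℂ) := by exact_mod_cast hε
    have hI : ((ε : ℂ) • (1 : Matrix (Fin k) (Fin k) ℂ)).PosDef := PosDef.one.smul hε'
    have hpert : (fromBlocks (C₁ + (ε : ℂ) • 1) D D C₂).PosSemidef := by
      have hblock : (fromBlocks ((ε : ℂ) • (1 : Matrix (Fin k) (Fin k) ℂ)) 0 0
          (0 : Matrix (Fin k) (Fin k) ℂ)).PosSemidef := by
        have := hI.isUnit.invertible
        simpa using (PosDef.fromBlocks₁₁ (0 : Matrix (Fin k) (Fin k) ℂ) 0 hI).mpr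
          (by simpa using PosSemidef.zero)
      simpa [fromBlocks_add] using hC.add hblock
    have := PosDef.posSemidef_pencil hp2 hd (PosDef.posSemidef_add hC₁ hI) hD hpert
    rw [add_kronecker, smul_kronecker] at this
    convert this using 1
    abel
end

section
/- Let m ≥ 2, n ≥ 1, and let B₀, B₁, …, B_m ∈ M_n(ℂ) be Hermitian matrices such that for all a₁, …, a_m ≥ 0 and all c ∈ ℝ with c² ≤ a₁·a₂, the matrix a₁B₁ + ⋯ + a_mB_m + c·B₀ is positive semidefinite (i.e., the linear map Φ on span({E_jj : 1 ≤ j ≤ m} ∪ {E₁₂+E₂₁}) ⊆ M_m(ℂ) with Φ(E_jj) = B_j and Φ(E₁₂+E₂₁) = B₀ is positive). Then for every k ≥ 1 and all matrices C₁, …, C_m, D ∈ M_k(ℂ) with each C_j positive semidefinite, D Hermitian, and the block matrix [[C₁, D],[D, C₂]] positive semidefinite, the matrix C₁ ⊗ B₁ + ⋯ + C_m ⊗ B_m + D ⊗ B₀ is positive semidefinite (i.e., Φ is completely positive). -/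
open Matrix
open scoped Kronecker ComplexOrder

namespace Matrix

variable {ι κ : Type*} [Fintype ι] [Fintype κ] [DecidableEq ι]

/-- A positive definite and a Hermitian matrix can be diagonalized simultaneously by congruence. -/
theorem PosDef.exists_simultaneous_congruence {A D : Matrix ι ι ℂ} (hA : A.PosDef)
    (hD : D.IsHermitian) :
    ∃ (P : Matrix ι ι ℂ) (d : ι → ℝ), Pᴴ * P = A ∧
      Pᴴ * diagonal (fun i => (d i : ℂ)) * P = D := by
  obtain ⟨S, hS, hSA⟩ : ∃ S : Matrix ι ι ℂ, IsUnit S.det ∧ A = Sᴴ * S := by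
    open scoped MatrixOrder in
    obtain ⟨S, hS⟩ := CStarAlgebra.nonneg_iff_eq_star_mul_self.mp hA.posSemidef.nonneg
    refine ⟨S, ?_, hS⟩
    have h := (isUnit_iff_isUnit_det A).mp hA.isUnit
    rw [hS, det_mul] at h
    exact isUnit_of_mul_isUnit_right h
  have hH : (S⁻¹ᴴ * D * S⁻¹).IsHermitian := isHermitian_conjTranspose_mul_mul _ hD
  set U : Matrix ι ι ℂ := (hH.eigenvectorUnitary : Matrix ι ι ℂ) with hU
  have hUU : U * Uᴴ = 1 := Unitary.coe_mul_star_self hH.eigenvectorUnitary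
  have hspec : S⁻¹ᴴ * D * S⁻¹ = U * diagonal (fun i => (hH.eigenvalues i : ℂ)) * Uᴴ :=
    hH.spectral_theorem
  have hSS : S⁻¹ * S = 1 := nonsing_inv_mul S hS
  have hSS' : Sᴴ * S⁻¹ᴴ = 1 := by rw [← conjTranspose_mul, hSS, conjTranspose_one]
  refine ⟨Uᴴ * S, hH.eigenvalues, ?_, ?_⟩
  · calc (Uᴴ * S)ᴴ * (Uᴴ * S) = Sᴴ * (U * Uᴴ) * S := by
          simp only [conjTranspose_mul, conjTranspose_conjTranspose, Matrix.mul_assoc]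
      _ = A := by rw [hUU, Matrix.mul_one, hSA]
  · calc (Uᴴ * S)ᴴ * diagonal (fun i => (hH.eigenvalues i : ℂ)) * (Uᴴ * S)
        = Sᴴ * (U * diagonal (fun i => (hH.eigenvalues i : ℂ)) * Uᴴ) * S := by
          simp only [conjTranspose_mul, conjTranspose_conjTranspose, Matrix.mul_assoc]
      _ = (Sᴴ * S⁻¹ᴴ) * D * (S⁻¹ * S) := by rw [← hspec]; simp only [Matrix.mul_assoc]
      _ = D := by rw [hSS, hSS', Matrix.one_mul, Matrix.mul_one]

theorem posSemidef_diagonal_kronecker_add {B₀ B₁ B₂ : Matrix κ κ ℂ}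
    (hB : ∀ t : ℝ, (B₁ + (t ^ 2 : ℂ) • B₂ + (t : ℂ) • B₀).PosSemidef) (d : ι → ℝ) :
    ((1 : Matrix ι ι ℂ) ⊗ₖ B₁ + diagonal (fun i => (d i ^ 2 : ℂ)) ⊗ₖ B₂ +
      diagonal (fun i => (d i : ℂ)) ⊗ₖ B₀).PosSemidef := by
  have hsum : (1 : Matrix ι ι ℂ) ⊗ₖ B₁ + diagonal (fun i => (d i ^ 2 : ℂ)) ⊗ₖ B₂ +
      diagonal (fun i => (d i : ℂ)) ⊗ₖ B₀ =
      ∑ i, diagonal (Pi.single i (1 : ℂ)) ⊗ₖ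
        (B₁ + (d i ^ 2 : ℂ) • B₂ + (d i : ℂ) • B₀) := by
    ext ⟨i, p⟩ ⟨j, q⟩
    rw [sum_apply]
    by_cases hij : i = j
    · subst hij
      simp [kroneckerMap_apply, Pi.single_apply]
    · simp [kroneckerMap_apply, diagonal_apply_ne _ hij, one_apply_ne hij]
  rw [hsum]
  exact posSemidef_sum _ fun i _ => .kronecker
    (.diagonal (Pi.single_nonneg.mpr zero_le_one)) (hB (d i))

theorem PosDef.posSemidef_kronecker_add {B₀ B₁ B₂ : Matrix κ κ ℂ}
    (hB : ∀ t : ℝ, (B₁ + (t ^ 2 : ℂ) • B₂ + (t : ℂ) • B₀).PosSemidef) (hB₂ : B₂.PosSemidef)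
    {A C D : Matrix ι ι ℂ} (hA : A.PosDef) (hD : D.IsHermitian)
    (h : (fromBlocks A D D C).PosSemidef) :
    (A ⊗ₖ B₁ + C ⊗ₖ B₂ + D ⊗ₖ B₀).PosSemidef := by
  classical
  obtain ⟨P, d, hPA, hPD⟩ := hA.exists_simultaneous_congruence hD
  have hdet : IsUnit A.det := (isUnit_iff_isUnit_det A).mp hA.isUnit
  let : Invertible A := A.invertibleOfIsUnitDet hdet
  have hschur : (C - D * A⁻¹ * D).PosSemidef := by
    have h' : (fromBlocks A D Dᴴ C).PosSemidef := by rwa [hD.eq]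
    simpa only [hD.eq] using (PosDef.fromBlocks₁₁ D C hA).mp h'
  have hP : IsUnit P.det := by
    rw [← hPA, det_mul] at hdet
    exact isUnit_of_mul_isUnit_right hdet
  have hPP : P * A⁻¹ * Pᴴ = 1 := by
    have hP' : IsUnit Pᴴ.det := by rw [det_conjTranspose]; exact hP.star
    rw [← hPA, mul_inv_rev, ← Matrix.mul_assoc, mul_nonsing_inv P hP, Matrix.one_mul,
      nonsing_inv_mul _ hP']
  have hDAD : Pᴴ * diagonal (fun i => (d i ^ 2 : ℂ)) * P = D * A⁻¹ * D := by
    set Λ := diagonal (fun i => (d i : ℂ)) with hΛ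
    have hsq : diagonal (fun i => (d i ^ 2 : ℂ)) = Λ * Λ := by
      simp [hΛ, diagonal_mul_diagonal, sq]
    calc Pᴴ * diagonal (fun i => (d i ^ 2 : ℂ)) * P
        = Pᴴ * Λ * (P * A⁻¹ * Pᴴ) * Λ * P := by
          rw [hPP, hsq]; simp only [Matrix.mul_assoc, Matrix.one_mul]
      _ = (Pᴴ * Λ * P) * A⁻¹ * (Pᴴ * Λ * P) := by simp only [Matrix.mul_assoc]
      _ = D * A⁻¹ * D := by rw [hPD]
  have hcongr : ∀ (X : Matrix ι ι ℂ) (Y : Matrix κ κ ℂ),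
      (P ⊗ₖ (1 : Matrix κ κ ℂ))ᴴ * (X ⊗ₖ Y) * (P ⊗ₖ (1 : Matrix κ κ ℂ)) =
        (Pᴴ * X * P) ⊗ₖ Y := fun X Y => by
    rw [conjTranspose_kronecker, ← mul_kronecker_mul, ← mul_kronecker_mul, conjTranspose_one,
      Matrix.one_mul, Matrix.mul_one]
  have hmain := ((posSemidef_diagonal_kronecker_add hB d).conjTranspose_mul_mul_same
    (P ⊗ₖ (1 : Matrix κ κ ℂ))).add (hschur.kronecker hB₂)
  rw [Matrix.mul_add, Matrix.mul_add, Matrix.add_mul, Matrix.add_mul, hcongr, hcongr, hcongr,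
    Matrix.mul_one, hPA, hPD, hDAD] at hmain
  convert hmain using 1
  ext ⟨i, p⟩ ⟨j, q⟩
  simp only [add_apply, sub_apply, kroneckerMap_apply]
  ring

/-- If `X + ε N` is positive semidefinite for every `ε > 0`, then so is `X`. -/
theorem posSemidef_of_forall_pos_add_smul_s7 {X N : Matrix κ κ ℂ}
    (h : ∀ ε : ℝ, 0 < ε → (X + (ε : ℂ) • N).PosSemidef) (hN : N.IsHermitian) :
    X.PosSemidef := by
  refine .of_dotProduct_mulVec_nonneg ?_ fun x => ?_
  · simpa using (h 1 one_pos).isHermitian.sub hN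
  · have hlim : Filter.Tendsto
        (fun ε : ℝ => star x ⬝ᵥ (X *ᵥ x) + (ε : ℂ) * (star x ⬝ᵥ (N *ᵥ x)))
        (nhdsWithin 0 (Set.Ioi 0)) (nhds (star x ⬝ᵥ (X *ᵥ x))) := by
      have hcont : Continuous
          (fun ε : ℝ => star x ⬝ᵥ (X *ᵥ x) + (ε : ℂ) * (star x ⬝ᵥ (N *ᵥ x))) := by
        fun_prop
      simpa using (hcont.tendsto 0).mono_left nhdsWithin_le_nhds
    refine ge_of_tendsto hlim ?_
    filter_upwards [self_mem_nhdsWithin] with ε hε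
    simpa [add_mulVec, smul_mulVec] using (h ε hε).dotProduct_mulVec_nonneg x

theorem posSemidef_kronecker_add_of_fromBlocks {B₀ B₁ B₂ : Matrix κ κ ℂ}
    (hB : ∀ t : ℝ, (B₁ + (t ^ 2 : ℂ) • B₂ + (t : ℂ) • B₀).PosSemidef) (hB₂ : B₂.PosSemidef)
    {A C D : Matrix ι ι ℂ} (hA : A.PosSemidef) (hD : D.IsHermitian)
    (h : (fromBlocks A D D C).PosSemidef) :
    (A ⊗ₖ B₁ + C ⊗ₖ B₂ + D ⊗ₖ B₀).PosSemidef := by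
  have hB₁ : B₁.PosSemidef := by simpa using hB 0
  refine posSemidef_of_forall_pos_add_smul_s7 (N := (1 : Matrix ι ι ℂ) ⊗ₖ B₁) (fun ε hε => ?_)
    (PosSemidef.one.kronecker hB₁).isHermitian
  have hε' : (0 : ℂ) < (ε : ℂ) := by exact_mod_cast hε
  have hAε : (A + (ε : ℂ) • (1 : Matrix ι ι ℂ)).PosDef :=
    PosDef.posSemidef_add hA (PosDef.one.smul hε')
  have hblock : (fromBlocks (A + (ε : ℂ) • (1 : Matrix ι ι ℂ)) D D C).PosSemidef := by
    have hdiag : (diagonal (Sum.elim (fun _ : ι => (ε : ℂ)) (fun _ : ι => 0))).PosSemidef :=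
      .diagonal (by rintro (i | i) <;> simp [hε'.le])
    convert h.add hdiag using 1
    rw [← fromBlocks_diagonal, fromBlocks_add, smul_one_eq_diagonal]
    simp
  convert hAε.posSemidef_kronecker_add hB hB₂ hD hblock using 1
  rw [add_kronecker, smul_kronecker]
  abel

end Matrix

/-- Let `m ≥ 2` and let `B₀, B₁, …, B_m ∈ M_n(ℂ)` be Hermitian such that
`a₁B₁ + ⋯ + a_mB_m + cB₀` is positive semidefinite whenever `a₁, …, a_m ≥ 0` and
`c² ≤ a₁a₂` (positivity of the map `Φ` on
`span({E_jj : 1 ≤ j ≤ m} ∪ {E₁₂+E₂₁}) ⊆ M_m(ℂ)` with `Φ(E_jj) = B_j`,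
`Φ(E₁₂+E₂₁) = B₀`). Then for every `k ≥ 1` and all `C₁, …, C_m, D ∈ M_k(ℂ)` with each
`C_j` positive semidefinite, `D` Hermitian, and `[[C₁, D], [D, C₂]]` positive
semidefinite, the matrix `C₁ ⊗ B₁ + ⋯ + C_m ⊗ B_m + D ⊗ B₀` is positive semidefinite
(`Φ` is completely positive). -/
theorem positive_map_on_span_diag_and_E12_completely_positive {m n : ℕ}
    (hm : 2 ≤ m) (hn : 1 ≤ n)
    (B₀ : Matrix (Fin n) (Fin n) ℂ) (B : Fin m → Matrix (Fin n) (Fin n) ℂ)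
    (hB0 : B₀.IsHermitian) (hB : ∀ j, (B j).IsHermitian)
    (hpos : ∀ a : Fin m → ℝ, (∀ j, 0 ≤ a j) → ∀ c : ℝ,
      c ^ 2 ≤ a ⟨0, by omega⟩ * a ⟨1, by omega⟩ →
      (∑ j, (a j : ℂ) • B j + (c : ℂ) • B₀).PosSemidef) :
    ∀ (k : ℕ), 1 ≤ k →
      ∀ (C : Fin m → Matrix (Fin k) (Fin k) ℂ) (D : Matrix (Fin k) (Fin k) ℂ),
      (∀ j, (C j).PosSemidef) → D.IsHermitian →
      (Matrix.fromBlocks (C ⟨0, by omega⟩) D D (C ⟨1, by omega⟩)).PosSemidef →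
      (∑ j, C j ⊗ₖ B j + D ⊗ₖ B₀).PosSemidef := by
  intro k _ C D hC hD hblock
  set i₀ : Fin m := ⟨0, by omega⟩ with hi₀
  set i₁ : Fin m := ⟨1, by omega⟩ with hi₁
  have hne : i₀ ≠ i₁ := by simp [hi₀, hi₁]
  have hsingle : ∀ (j : Fin m) {r : ℝ}, 0 ≤ r → ∀ i, 0 ≤ (Pi.single j r : Fin m → ℝ) i :=
    fun j r hr i => by
      rw [Pi.single_apply]
      split_ifs
      exacts [hr, le_rfl]
  have hBpos : ∀ j, (B j).PosSemidef := fun j => by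
    have h := hpos (Pi.single j 1) (hsingle j zero_le_one) 0
      (by simpa using mul_nonneg (hsingle j zero_le_one i₀) (hsingle j zero_le_one i₁))
    simpa [Pi.single_apply] using h
  have hsplit : ∀ {M : Type} [AddCommMonoid M] (f : Fin m → M),
      ∑ j, f j = f i₀ + f i₁ + ∑ j ∈ Finset.univ \ {i₀, i₁}, f j := fun f => by
    rw [← Finset.sum_sdiff (Finset.subset_univ {i₀, i₁}), Finset.sum_pair hne, add_comm]
  have hpair : ∀ t : ℝ, (B i₀ + (t ^ 2 : ℂ) • B i₁ + (t : ℂ) • B₀).PosSemidef := fun t => by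
    have h := hpos (Pi.single i₀ 1 + Pi.single i₁ (t ^ 2))
      (fun i => add_nonneg (hsingle i₀ zero_le_one i) (hsingle i₁ (sq_nonneg t) i)) t
      (by simp [hne, hne.symm])
    simpa [Pi.single_apply, add_smul, Finset.sum_add_distrib, ite_smul,
      apply_ite Complex.ofReal] using h
  have hmain := posSemidef_kronecker_add_of_fromBlocks hpair (hBpos i₁) (hC i₀) hD hblock
  rw [hsplit, add_right_comm]
  exact hmain.add (posSemidef_sum _ fun j _ => (hC j).kronecker (hBpos j))
end

section
/- Let r > 1, let c ∈ [−1, 1], and let t ∈ ℝ. Then cos t · (1/(r+1) − r·c²/(r²−1)) + sin t · (c/√(r²−1)) ≤ 1/(r+1) + c²/(r²−1). -/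
/-- Cauchy–Schwarz against a unit vector `(cos t, sin t)`. -/
lemma cos_mul_add_sin_mul_le {a b R : ℝ} (t : ℝ) (hR : 0 ≤ R) (h : a ^ 2 + b ^ 2 ≤ R ^ 2) :
    Real.cos t * a + Real.sin t * b ≤ R := by
  refine le_of_sq_le_sq ?_ hR
  calc (Real.cos t * a + Real.sin t * b) ^ 2
      = (Real.sin t ^ 2 + Real.cos t ^ 2) * (a ^ 2 + b ^ 2)
          - (Real.cos t * b - Real.sin t * a) ^ 2 := by ring
    _ ≤ a ^ 2 + b ^ 2 := by
      rw [Real.sin_sq_add_cos_sq, one_mul]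
      exact sub_le_self _ (sq_nonneg _)
    _ ≤ R ^ 2 := h

/-- For `r > 1`, `c ∈ [−1, 1]` and `t ∈ ℝ`,
`cos t · (1/(r+1) − r·c²/(r²−1)) + sin t · (c/√(r²−1)) ≤ 1/(r+1) + c²/(r²−1)`. -/
theorem scalar_inequality (r c t : ℝ) (hr : 1 < r) (hc : c ∈ Set.Icc (-1 : ℝ) 1) :
    Real.cos t * (1 / (r + 1) - r * c ^ 2 / (r ^ 2 - 1))
      + Real.sin t * (c / Real.sqrt (r ^ 2 - 1))
      ≤ 1 / (r + 1) + c ^ 2 / (r ^ 2 - 1) := by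
  have hr₁ : 0 < r - 1 := sub_pos.2 hr
  have hr₂ : 0 < r + 1 := by linarith
  have hD : 0 < r ^ 2 - 1 := by nlinarith
  have hc₁ : 0 ≤ 1 - c ^ 2 := by nlinarith [hc.1, hc.2]
  refine cos_mul_add_sin_mul_le t (by positivity) ?_
  rw [div_pow c, Real.sq_sqrt hD.le, ← sub_nonneg]
  have key : (1 / (r + 1) + c ^ 2 / (r ^ 2 - 1)) ^ 2
      - ((1 / (r + 1) - r * c ^ 2 / (r ^ 2 - 1)) ^ 2 + c ^ 2 / (r ^ 2 - 1))
      = c ^ 2 * (1 - c ^ 2) / (r ^ 2 - 1) := by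
    have hfac : r ^ 2 - 1 = (r - 1) * (r + 1) := by ring
    rw [hfac]
    field_simp
    ring
  rw [key]
  positivity
end

section
/- Let r > 1 and let C ∈ M_n(ℂ) be a Hermitian matrix with −I ≤ C ≤ I (a Hermitian contraction). Then for every t ∈ ℝ, cos t · ((1/(r+1))·I − (r/(r²−1))·C²) + sin t · (1/√(r²−1))·C ≤ (1/(r+1))·I + (1/(r²−1))·C², where ≤ is the partial order given by positive semidefiniteness of the difference. -/
open Matrix
open scoped ComplexOrder

/-- If `C` is a Hermitian contraction, then `I - C²` is positive semidefinite. -/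
theorem posSemidef_one_sub_sq_of_contraction {n : ℕ} {C : Matrix (Fin n) (Fin n) ℂ}
    (hC1 : ((1 : Matrix (Fin n) (Fin n) ℂ) + C).PosSemidef)
    (hC2 : ((1 : Matrix (Fin n) (Fin n) ℂ) - C).PosSemidef) :
    ((1 : Matrix (Fin n) (Fin n) ℂ) - C ^ 2).PosSemidef := by
  have h1 := hC2.mul_mul_conjTranspose_same (1 + C)
  have h2 := hC1.mul_mul_conjTranspose_same (1 - C)
  rw [hC1.isHermitian.eq] at h1
  rw [hC2.isHermitian.eq] at h2
  have h := (h1.add h2).smul (show (0 : ℝ) ≤ 1 / 2 by norm_num)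
  convert h using 1
  have e : (1 + C) * (1 - C) * (1 + C) + (1 - C) * (1 + C) * (1 - C)
      = (2 : ℝ) • (1 - C ^ 2) := by
    rw [two_smul]
    noncomm_ring
  rw [e, smul_smul]
  norm_num

/-- For `r > 1` and a Hermitian contraction `C ∈ M_n(ℂ)` (so `−I ≤ C ≤ I`), for every real
`t` we have
`cos t · ((1/(r+1))I − (r/(r²−1))C²) + sin t · (1/√(r²−1))C ≤ (1/(r+1))I + (1/(r²−1))C²`,
where `X ≤ Y` means `Y − X` is positive semidefinite. -/
theorem matrix_inequality_hermitian_contraction {n : ℕ} (r : ℝ) (hr : 1 < r)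
    (C : Matrix (Fin n) (Fin n) ℂ) (hC : C.IsHermitian)
    (hC1 : ((1 : Matrix (Fin n) (Fin n) ℂ) + C).PosSemidef)
    (hC2 : ((1 : Matrix (Fin n) (Fin n) ℂ) - C).PosSemidef) (t : ℝ) :
    (((1 / (r + 1)) • (1 : Matrix (Fin n) (Fin n) ℂ) + (1 / (r ^ 2 - 1)) • C ^ 2)
      - (Real.cos t • ((1 / (r + 1)) • (1 : Matrix (Fin n) (Fin n) ℂ)
            - (r / (r ^ 2 - 1)) • C ^ 2)
        + Real.sin t • ((1 / Real.sqrt (r ^ 2 - 1)) • C))).PosSemidef := by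
  set α := Real.sqrt (r + 1)
  set β := Real.sqrt (r - 1)
  have hα2 : α ^ 2 = r + 1 := Real.sq_sqrt (by linarith)
  have hβ2 : β ^ 2 = r - 1 := Real.sq_sqrt (by linarith)
  have hα0 : 0 < α := Real.sqrt_pos.2 (by linarith)
  have hβ0 : 0 < β := Real.sqrt_pos.2 (by linarith)
  have hαβ : r ^ 2 - 1 = (α * β) ^ 2 := by rw [mul_pow, hα2, hβ2]; ring
  have hsqrt : Real.sqrt (r ^ 2 - 1) = α * β := by
    rw [hαβ, Real.sqrt_sq (by positivity)]
  set x := Real.cos (t / 2)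
  set y := Real.sin (t / 2)
  have hxy : x ^ 2 + y ^ 2 = 1 := Real.cos_sq_add_sin_sq _
  have hcos : Real.cos t = x ^ 2 - y ^ 2 := by
    rw [← Real.cos_two_mul']; congr 1; ring
  have hsin : Real.sin t = 2 * y * x := by
    rw [← Real.sin_two_mul]; congr 1; ring
  have hD : ((α * x) • C - (β * y) • (1 : Matrix (Fin n) (Fin n) ℂ)).IsHermitian := by
    simp [IsHermitian, conjTranspose_smul, hC.eq]
  have h1 := posSemidef_self_mul_conjTranspose
    ((α * x) • C - (β * y) • (1 : Matrix (Fin n) (Fin n) ℂ))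
  rw [hD.eq] at h1
  have h2 := (posSemidef_one_sub_sq_of_contraction hC1 hC2).smul
    (show 0 ≤ (β * y) ^ 2 by positivity)
  have h := (h1.add h2).smul (show 0 ≤ 1 / (α * β) ^ 2 by positivity)
  convert h using 1
  have hsq : ((α * x) • C - (β * y) • (1 : Matrix (Fin n) (Fin n) ℂ))
      * ((α * x) • C - (β * y) • (1 : Matrix (Fin n) (Fin n) ℂ))
      = (α * x) ^ 2 • C ^ 2 - (2 * (α * x) * (β * y)) • C
        + (β * y) ^ 2 • (1 : Matrix (Fin n) (Fin n) ℂ) := by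
    simp only [sub_mul, mul_sub, smul_mul_assoc, mul_smul_comm, one_mul, mul_one, ← sq C]
    module
  have e0 : 1 / (r + 1) - Real.cos t * (1 / (r + 1))
      = 1 / (α * β) ^ 2 * (2 * (β * y) ^ 2) := by
    rw [hcos, ← hα2]
    field_simp
    linear_combination -hxy
  have e1 : Real.sin t * (1 / Real.sqrt (r ^ 2 - 1))
      = 1 / (α * β) ^ 2 * (2 * (α * x) * (β * y)) := by
    rw [hsin, hsqrt]
    field_simp
  have e2 : 1 / (r ^ 2 - 1) + Real.cos t * (r / (r ^ 2 - 1))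
      = 1 / (α * β) ^ 2 * ((α * x) ^ 2 - (β * y) ^ 2) := by
    rw [hcos, hαβ, mul_pow α x, mul_pow β y, hα2, hβ2]
    field_simp
    linear_combination -hxy
  rw [hsq]
  trans (1 / (r + 1) - Real.cos t * (1 / (r + 1))) • (1 : Matrix (Fin n) (Fin n) ℂ)
    - (Real.sin t * (1 / Real.sqrt (r ^ 2 - 1))) • C
    + (1 / (r ^ 2 - 1) + Real.cos t * (r / (r ^ 2 - 1))) • C ^ 2
  · module
  · rw [e0, e1, e2]
    module
end

section
/- Let r > 1 and let t₀ = arccos(−1/r) ∈ (0, π). Let H, G ∈ M_n(ℂ) be Hermitian matrices such that √(r²−1)·G ≤ H, −√(r²−1)·G ≤ H, and cos t · (H − r·I) + sin t · G ≤ I for all t ∈ [−t₀, t₀]. Then there exists a Hermitian matrix P ∈ M_n(ℂ) with 0 ≤ P ≤ I such that cos t · H + sin t · G ≤ (1 + r·cos t)·P for all t ∈ [−π, π]. -/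
open Matrix
open scoped ComplexOrder

section

open scoped MatrixOrder Matrix.Norms.L2Operator

namespace Matrix

variable {n : Type*}

/-- The matrices `K` for which the quadratic pencil `y² A + y K + B` is positive semidefinite
on the whole real line. -/
def pencilSet (A B : Matrix n n ℂ) : Set (Matrix n n ℂ) :=
  {K | ∀ y : ℝ, (y ^ 2 • A + y • K + B).PosSemidef}

theorem add_add_posSemidef_of_mem_pencilSet {A B K : Matrix n n ℂ} (hK : K ∈ pencilSet A B) :
    (A + K + B).PosSemidef := by
  simpa using hK 1

theorem convex_pencilSet (A B : Matrix n n ℂ) : Convex ℝ (pencilSet A B) := by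
  intro K hK K' hK' a b ha hb hab y
  convert ((hK y).smul ha).add ((hK' y).smul hb) using 1
  obtain rfl : b = 1 - a := by linarith
  module

theorem posSemidef_of_mem_pencilSet {A B K : Matrix n n ℂ} (hA : A.PosSemidef)
    (hK : K ∈ pencilSet A B) {α β κ : ℝ} (hα : 0 ≤ α) (hβ : 0 ≤ β) (h : κ ^ 2 = α * β) :
    (α • A + κ • K + β • B).PosSemidef := by
  obtain rfl | hβ := hβ.eq_or_lt
  · obtain rfl : κ = 0 := by simpa using h
    simpa using hA.smul hα
  · convert (hK (κ / β)).smul hβ.le using 1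
    have : α = β * (κ / β) ^ 2 := by field_simp; linarith
    have h' : κ = β * (κ / β) := by field_simp
    rw [smul_add, smul_add, smul_smul, smul_smul, ← this, ← h']

variable [Fintype n] [DecidableEq n]

theorem PosDef.exists_posDef_mul_self_eq {M : Matrix n n ℂ} (hM : M.PosDef) :
    ∃ S : Matrix n n ℂ, S.PosDef ∧ S * S = M := by
  have hS := CFC.sqrt_mul_sqrt_self M hM.posSemidef.nonneg
  refine ⟨CFC.sqrt M, ?_, hS⟩
  rw [(CFC.sqrt_nonneg M).posSemidef.posDef_iff_isUnit]
  exact isUnit_of_mul_isUnit_left (hS ▸ hM.isUnit)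

theorem PosDef.exists_mul_mul_self_eq {P R : Matrix n n ℂ} (hP : P.PosDef) (hR : R.PosDef) :
    ∃ Y : Matrix n n ℂ, Y.PosDef ∧ Y * P * Y = R := by
  obtain ⟨p, hp, rfl⟩ := hP.exists_posDef_mul_self_eq
  have hpRp : (p * R * p).PosDef := by
    have := hR.conjTranspose_mul_mul_same (mulVec_injective_of_isUnit hp.isUnit)
    rwa [hp.isHermitian.eq] at this
  obtain ⟨m, hm, hmm⟩ := hpRp.exists_posDef_mul_self_eq
  have h1 : p * p⁻¹ = 1 := mul_nonsing_inv _ ((isUnit_iff_isUnit_det _).1 hp.isUnit)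
  have h2 : p⁻¹ * p = 1 := nonsing_inv_mul _ ((isUnit_iff_isUnit_det _).1 hp.isUnit)
  refine ⟨p⁻¹ * m * p⁻¹, ?_, ?_⟩
  · have := hm.conjTranspose_mul_mul_same (mulVec_injective_of_isUnit hp.inv.isUnit)
    rwa [hp.inv.isHermitian.eq] at this
  · calc p⁻¹ * m * p⁻¹ * (p * p) * (p⁻¹ * m * p⁻¹)
        = p⁻¹ * m * (p⁻¹ * p) * (p * p⁻¹) * m * p⁻¹ := by simp only [mul_assoc]
      _ = p⁻¹ * (m * m) * p⁻¹ := by rw [h1, h2]; simp only [mul_assoc, mul_one]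
      _ = (p⁻¹ * p) * R * (p * p⁻¹) := by rw [hmm]; simp only [mul_assoc]
      _ = R := by rw [h1, h2, one_mul, mul_one]

/-- A factorization `ρ = τ τᴴ` such that `τᴴ B τ = D (τᴴ A τ) D` with `D` diagonal and positive. -/
theorem PosDef.exists_factorization {ρ A B : Matrix n n ℂ} (hρ : ρ.PosDef) (hA : A.PosDef)
    (hB : B.PosDef) :
    ∃ (τ : Matrix n n ℂ) (d : n → ℝ), IsUnit τ ∧ (∀ i, 0 < d i) ∧ τ * τᴴ = ρ ∧
      diagonal (fun i => (d i : ℂ)) * (τᴴ * A * τ) * diagonal (fun i => (d i : ℂ)) =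
        τᴴ * B * τ := by
  obtain ⟨σ, hσ, rfl⟩ := hρ.exists_posDef_mul_self_eq
  have hinj := mulVec_injective_of_isUnit hσ.isUnit
  obtain ⟨Y, hY, hYR⟩ := (hA.conjTranspose_mul_mul_same hinj).exists_mul_mul_self_eq
    (hB.conjTranspose_mul_mul_same hinj)
  have hspec := hY.isHermitian.spectral_theorem
  rw [Unitary.conjStarAlgAut_apply] at hspec
  set U : Matrix n n ℂ := (hY.isHermitian.eigenvectorUnitary : Matrix n n ℂ)
  have hU1 : U * Uᴴ = 1 := Unitary.mul_star_self_of_mem hY.isHermitian.eigenvectorUnitary.2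
  have hU2 : Uᴴ * U = 1 := Unitary.star_mul_self_of_mem hY.isHermitian.eigenvectorUnitary.2
  have hD : Uᴴ * Y * U = diagonal (fun i => (hY.isHermitian.eigenvalues i : ℂ)) := by
    calc Uᴴ * Y * U
        = Uᴴ * (U * diagonal (RCLike.ofReal ∘ hY.isHermitian.eigenvalues) * Uᴴ) * U :=
          congrArg (fun X => Uᴴ * X * U) hspec
      _ = (Uᴴ * U) * diagonal (RCLike.ofReal ∘ hY.isHermitian.eigenvalues) * (Uᴴ * U) := by
          simp only [mul_assoc]
      _ = _ := by rw [hU2, one_mul, mul_one]; rfl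
  refine ⟨σ * U, hY.isHermitian.eigenvalues,
    hσ.isUnit.mul (IsUnit.of_mul_eq_one _ hU1), hY.eigenvalues_pos, ?_, ?_⟩
  · rw [conjTranspose_mul, hσ.isHermitian.eq]
    calc σ * U * (Uᴴ * σ) = σ * (U * Uᴴ) * σ := by simp only [mul_assoc]
      _ = σ * σ := by rw [hU1, mul_one]
  · rw [← hD, conjTranspose_mul]
    calc Uᴴ * Y * U * (Uᴴ * σᴴ * A * (σ * U)) * (Uᴴ * Y * U)
        = Uᴴ * Y * (U * Uᴴ) * (σᴴ * A * σ) * (U * Uᴴ) * Y * U := by simp only [mul_assoc]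
      _ = Uᴴ * (Y * (σᴴ * A * σ) * Y) * U := by rw [hU1]; simp only [mul_assoc, one_mul]
      _ = Uᴴ * σᴴ * B * (σ * U) := by rw [hYR]; simp only [mul_assoc]

theorem isClosed_setOf_posSemidef : IsClosed {M : Matrix n n ℂ | M.PosSemidef} := by
  simp only [← nonneg_iff_posSemidef]
  exact isClosed_Ici

/-- Every real linear functional on matrices is `X ↦ Re tr (ρ X)` for some `ρ`. -/
theorem exists_re_trace_mul_eq (f : StrongDual ℝ (Matrix n n ℂ)) :
    ∃ ρ : Matrix n n ℂ, ∀ X, f X = (ρ * X).trace.re := by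
  set g : StrongDual ℂ (Matrix n n ℂ) := f.extendRCLike
  refine ⟨of fun i j => g (single j i 1), fun X => ?_⟩
  rw [← StrongDual.re_extendRCLike_apply (𝕜 := ℂ) f X]
  have : g X = ((of fun i j => g (single j i 1)) * X).trace := by
    conv_lhs => rw [matrix_eq_sum_single X]
    simp only [map_sum, trace, diag, mul_apply, of_apply]
    rw [Finset.sum_comm]
    refine Finset.sum_congr rfl fun i _ => Finset.sum_congr rfl fun j _ => ?_
    rw [mul_comm, ← smul_eq_mul, ← map_smul, smul_single, smul_eq_mul, mul_one]
  rw [← this]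
  rfl

theorem exists_pencil_posSemidef_trace {ρ A B L : Matrix n n ℂ} (hρ : ρ.PosDef) (hA : A.PosDef)
    (hB : B.PosDef) (h : ∀ y : ℝ, 0 < y → (y ^ 2 • A + y • L + B).PosSemidef) :
    ∃ K : Matrix n n ℂ, (∀ y : ℝ, (y ^ 2 • A + y • K + B).PosSemidef) ∧
      0 ≤ (ρ * (L - K)).trace.re := by
  obtain ⟨τ, d, hτ, hd, rfl, hD⟩ := hρ.exists_factorization hA hB
  set D : Matrix n n ℂ := diagonal (fun i => (d i : ℂ))
  have hDH : Dᴴ = D := by simp [D, diagonal_conjTranspose, Pi.star_def]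
  obtain ⟨υ, h1, h2⟩ : ∃ υ, τ * υ = 1 ∧ υ * τ = 1 := ⟨_, hτ.mul_val_inv, hτ.val_inv_mul⟩
  have h1' : υᴴ * τᴴ = 1 := by rw [← conjTranspose_mul, h1, conjTranspose_one]
  have h2' : τᴴ * υᴴ = 1 := by rw [← conjTranspose_mul, h2, conjTranspose_one]
  set Z : Matrix n n ℂ := υᴴ * D * τᴴ with hZ
  have hZH : Zᴴ = τ * D * υ := by simp [hZ, hDH, mul_assoc]
  have hZZ : Z * A * Zᴴ = B := by
    rw [hZH]
    calc Z * A * (τ * D * υ) = υᴴ * (D * (τᴴ * A * τ) * D) * υ := by simp only [hZ, mul_assoc]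
      _ = (υᴴ * τᴴ) * B * (τ * υ) := by rw [hD]; simp only [mul_assoc]
      _ = B := by rw [h1, h1', one_mul, mul_one]
  refine ⟨-(Z * A + A * Zᴴ), fun y => ?_, ?_⟩
  · have := hA.posSemidef.mul_mul_conjTranspose_same (y • (1 : Matrix n n ℂ) - Z)
    convert this using 1
    rw [← hZZ]
    simp only [conjTranspose_sub, conjTranspose_smul, conjTranspose_one, star_trivial, sub_mul,
      mul_sub, smul_mul_assoc, mul_smul_comm, one_mul, mul_one, smul_sub, smul_smul]
    module
  · have e1 : (τ * τᴴ * (Z * A)).trace = (D * (τᴴ * A * τ)).trace := by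
      calc (τ * τᴴ * (Z * A)).trace = (τ * (τᴴ * υᴴ) * (D * τᴴ * A)).trace := by
            simp only [hZ, mul_assoc]
        _ = _ := by rw [h2', mul_one, trace_mul_comm]; simp only [mul_assoc]
    have e2 : (τ * τᴴ * (A * Zᴴ)).trace = (D * (τᴴ * A * τ)).trace := by
      calc (τ * τᴴ * (A * Zᴴ)).trace = ((τ * τᴴ * A * τ * D) * υ).trace := by
            simp only [hZH, mul_assoc]
        _ = ((υ * τ) * (τᴴ * A * τ * D)).trace := by rw [trace_mul_comm]; simp only [mul_assoc]
        _ = _ := by rw [h2, one_mul, trace_mul_comm]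
    have e3 : (τ * τᴴ * L).trace = (τᴴ * L * τ).trace := by
      rw [mul_assoc, trace_mul_comm]
    rw [sub_neg_eq_add, mul_add, mul_add, trace_add, trace_add, e1, e2, e3]
    simp only [trace, diag, Complex.add_re, Complex.re_sum, ← Finset.sum_add_distrib]
    refine Finset.sum_nonneg fun i _ => ?_
    have hi := ((h (d i) (hd i)).conjTranspose_mul_mul_same τ).diag_nonneg (i := i)
    have hBi : (τᴴ * B * τ) i i = d i ^ 2 * (τᴴ * A * τ) i i := by
      rw [← hD, mul_diagonal, diagonal_mul]; ring
    simp only [mul_add, add_mul, mul_smul_comm, smul_mul_assoc, add_apply, smul_apply, hBi] at hi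
    have hi' := (Complex.le_def.1 hi).1
    rw [diagonal_mul]
    simp only [Complex.add_re, Complex.zero_re, Complex.real_smul, ← Complex.ofReal_pow,
      Complex.re_ofReal_mul] at hi' ⊢
    have := hd i
    refine nonneg_of_mul_nonneg_right (a := d i) ?_ this
    linarith

theorem isClosed_pencilSet (A B : Matrix n n ℂ) : IsClosed (pencilSet A B) := by
  simp only [pencilSet, Set.ofPred_forall]
  exact isClosed_iInter fun y => isClosed_setOf_posSemidef.preimage (by fun_prop)

theorem isCompact_pencilSet (A B : Matrix n n ℂ) : IsCompact (pencilSet A B) := by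
  have : ProperSpace (Matrix n n ℂ) := FiniteDimensional.proper ℂ _
  refine Metric.isCompact_of_isClosed_isBounded (isClosed_pencilSet A B) ?_
  refine isBounded_iff_forall_norm_le.2 ⟨‖(2 : ℝ) • (A + B)‖ + ‖A + B‖, fun K hK => ?_⟩
  have h1 : 0 ≤ A + K + B := (add_add_posSemidef_of_mem_pencilSet hK).nonneg
  have h2 : A + K + B ≤ (2 : ℝ) • (A + B) := by
    rw [le_iff, show (2 : ℝ) • (A + B) - (A + K + B) = (-1 : ℝ) ^ 2 • A + (-1 : ℝ) • K + B by module]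
    exact hK (-1)
  calc ‖K‖ = ‖(A + K + B) - (A + B)‖ := by congr 1; abel
    _ ≤ _ := (norm_sub_le _ _).trans
      (by gcongr; exact CStarAlgebra.norm_le_norm_of_nonneg_of_le h1 h2)

theorem exists_posSemidef_re_trace_separation {S : Set (Matrix n n ℂ)} (hS : Convex ℝ S)
    (hSc : IsCompact S) (hSH : ∀ K ∈ S, K.IsHermitian) {L : Matrix n n ℂ} (hL : L.IsHermitian)
    (h : ∀ K ∈ S, ¬ (L - K).PosSemidef) :
    ∃ (ρ : Matrix n n ℂ) (δ : ℝ), ρ.PosSemidef ∧ 0 < δ ∧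
      ∀ K ∈ S, (ρ * (L - K)).trace.re < -δ := by
  have htc : Convex ℝ {X : Matrix n n ℂ | (L - X).PosSemidef} := by
    intro X hX X' hX' a b ha hb hab
    change (L - (a • X + b • X')).PosSemidef
    convert (PosSemidef.smul hX ha).add (PosSemidef.smul hX' hb) using 1
    obtain rfl : b = 1 - a := by linarith
    module
  have htcl : IsClosed {X : Matrix n n ℂ | (L - X).PosSemidef} :=
    isClosed_setOf_posSemidef.preimage (by fun_prop)
  obtain ⟨f, u, v, hfu, huv, hfv⟩ := geometric_hahn_banach_compact_closed hS hSc htc htcl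
    (Set.disjoint_left.2 h)
  obtain ⟨ρ, hρ⟩ := exists_re_trace_mul_eq f
  have hL' : v < f L := hfv L (by simp [PosSemidef.zero])
  have hneg : ∀ Q : Matrix n n ℂ, Q.PosSemidef → f Q ≤ 0 := by
    intro Q hQ
    by_contra! hpos
    have := hfv (L - ((f L - v) / f Q) • Q) (by
      change (L - (L - _)).PosSemidef
      rw [sub_sub_cancel]
      exact hQ.smul (div_pos (sub_pos.2 hL') hpos).le)
    rw [map_sub, map_smul, smul_eq_mul, div_mul_cancel₀ _ hpos.ne'] at this
    linarith
  have hsymm : ∀ X : Matrix n n ℂ, X.IsHermitian →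
      ((-(1 / 2 : ℝ) • (ρ + ρᴴ)) * X).trace.re = - f X := by
    intro X hX
    have : (ρᴴ * X).trace.re = (ρ * X).trace.re := by
      rw [← Complex.conj_re ((ρ * X).trace), ← Complex.star_def, ← trace_conjTranspose,
        conjTranspose_mul, hX.eq, trace_mul_comm]
    rw [hρ, smul_mul_assoc, trace_smul, add_mul, trace_add, Complex.smul_re, Complex.add_re, this,
      smul_eq_mul]
    ring
  refine ⟨-(1 / 2 : ℝ) • (ρ + ρᴴ), v - u, .of_dotProduct_mulVec_nonneg ?_ fun x => ?_,
    sub_pos.2 huv, fun K hK => ?_⟩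
  · simp [IsHermitian, add_comm]
  · have hH : (-(1 / 2 : ℝ) • (ρ + ρᴴ)).IsHermitian := by simp [IsHermitian, add_comm]
    have hx := posSemidef_vecMulVec_self_star x
    have := hsymm _ hx.isHermitian
    rw [mul_vecMulVec, trace_vecMulVec, dotProduct_comm] at this
    refine Complex.le_def.2 ⟨?_, ?_⟩
    · rw [this, Complex.zero_re]
      linarith [hneg _ hx]
    · exact (hH.im_star_dotProduct_mulVec_self x).symm
  · rw [hsymm _ (hL.sub (hSH K hK)), map_sub]
    linarith [hfu K hK]

theorem exists_mem_pencilSet_of_posDef {A B L : Matrix n n ℂ} (hA : A.PosDef)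
    (hB : B.PosDef) (hL : L.IsHermitian)
    (h : ∀ y : ℝ, 0 < y → (y ^ 2 • A + y • L + B).PosSemidef) :
    ∃ K ∈ pencilSet A B, (L - K).PosSemidef := by
  by_contra! hcon
  have hH : ∀ K ∈ pencilSet A B, K.IsHermitian := by
    intro K hK
    have := ((add_add_posSemidef_of_mem_pencilSet hK).isHermitian.sub hA.isHermitian).sub
      hB.isHermitian
    convert this using 1
    abel
  obtain ⟨ρ, δ, hρ, hδ, hsep⟩ := exists_posSemidef_re_trace_separation (convex_pencilSet A B)
    (isCompact_pencilSet A B) hH hL hcon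
  set c : ℝ := |(L + A + B).trace.re| + 1
  have hc : 0 < c := by positivity
  obtain ⟨K, hK, htr⟩ := exists_pencil_posSemidef_trace
    (ρ := ρ + (δ / c) • (1 : Matrix n n ℂ))
    (PosDef.posSemidef_add hρ (PosDef.one.smul (div_pos hδ hc))) hA hB h
  have h1 := hsep K hK
  have h2 : (L - K).trace.re ≤ c := by
    have := (Complex.le_def.1 (add_add_posSemidef_of_mem_pencilSet hK).trace_nonneg).1
    have h3 := le_abs_self (L + A + B).trace.re
    simp only [trace_add, trace_sub, Complex.add_re, Complex.sub_re, Complex.zero_re, c]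
      at this h3 ⊢
    linarith
  rw [add_mul, smul_mul_assoc, one_mul, trace_add, trace_smul, Complex.add_re, Complex.smul_re,
    smul_eq_mul] at htr
  have h4 : δ / c * (L - K).trace.re ≤ δ / c * c := by gcongr
  rw [div_mul_cancel₀ _ hc.ne'] at h4
  linarith

/-- If `y² A + y L + B ≥ 0` for all `y > 0`, then `L` may be decreased to some `K ≤ L` such that
`y² A + y K + B ≥ 0` for all real `y`. -/
theorem exists_mem_pencilSet {A B L : Matrix n n ℂ} (hA : A.PosSemidef)
    (hB : B.PosSemidef) (hL : L.IsHermitian)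
    (h : ∀ y : ℝ, 0 < y → (y ^ 2 • A + y • L + B).PosSemidef) :
    ∃ K ∈ pencilSet A B, (L - K).PosSemidef := by
  let T : ℝ → Set (Matrix n n ℂ) := fun ε =>
    pencilSet (A + ε • 1) (B + ε • 1) ∩ {K | (L - K).PosSemidef}
  have hmono : ∀ ε ε' : ℝ, ε ≤ ε' → T ε ⊆ T ε' := by
    refine fun ε ε' hε K hK => ⟨fun y => ?_, hK.2⟩
    convert (hK.1 y).add (PosSemidef.one.smul
      (mul_nonneg (sub_nonneg.2 hε) (by positivity : 0 ≤ y ^ 2 + 1))) using 1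
    module
  have hcl : ∀ ε, IsClosed (T ε) := fun ε =>
    (isClosed_pencilSet _ _).inter (isClosed_setOf_posSemidef.preimage (by fun_prop))
  have hne : ∀ m : ℕ, (T (1 / (m + 1))).Nonempty := by
    intro m
    have hε : 0 < 1 / ((m : ℝ) + 1) := by positivity
    refine exists_mem_pencilSet_of_posDef (PosDef.posSemidef_add hA (PosDef.one.smul hε))
      (PosDef.posSemidef_add hB (PosDef.one.smul hε)) hL fun y hy => ?_
    convert (h y hy).add (PosSemidef.one.smul
      (mul_nonneg hε.le (by positivity : 0 ≤ y ^ 2 + 1))) using 1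
    module
  have hsucc : ∀ m : ℕ, T (1 / ((m + 1 : ℕ) + 1)) ⊆ T (1 / (m + 1)) :=
    fun m => hmono _ _ (Nat.one_div_le_one_div m.le_succ)
  obtain ⟨K, hK⟩ := IsCompact.nonempty_iInter_of_sequence_nonempty_isCompact_isClosed
    (fun m : ℕ => T (1 / (m + 1))) hsucc hne
    ((isCompact_pencilSet _ _).inter_right
      (isClosed_setOf_posSemidef.preimage (by fun_prop))) (fun m => hcl _)
  rw [Set.mem_iInter] at hK
  refine ⟨K, fun y => ?_, (hK 0).2⟩
  have hcont : Continuous fun ε : ℝ => y ^ 2 • (A + ε • (1 : Matrix n n ℂ)) + y • K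
      + (B + ε • 1) := by fun_prop
  have hlim : Filter.Tendsto (fun m : ℕ => y ^ 2 • (A + (1 / ((m : ℝ) + 1)) • (1 : Matrix n n ℂ))
      + y • K + (B + (1 / ((m : ℝ) + 1)) • 1)) Filter.atTop (nhds (y ^ 2 • A + y • K + B)) := by
    simpa [Function.comp_def] using
      (hcont.tendsto 0).comp (tendsto_one_div_add_atTop_nhds_zero_nat (𝕜 := ℝ))
  exact isClosed_setOf_posSemidef.mem_of_tendsto hlim (.of_forall fun m => (hK m).1 y)

end Matrix

end


theorem exists_trig_parameter {r t₀ s y : ℝ} (hr : 1 < r) (ht₀ : t₀ = Real.arccos (-1 / r))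
    (hs : 0 < s) (hs2 : s ^ 2 = r ^ 2 - 1) (hy : 0 < y) :
    ∃ t ∈ Set.Icc (-t₀) t₀, ∃ κ : ℝ, 0 < κ ∧ 1 + r * Real.cos t = s * κ ∧
      (r + Real.cos t) / s - Real.sin t = κ * y ∧ (r + Real.cos t) / s + Real.sin t = κ / y := by
  set h : ℝ := (y + y⁻¹) / 2 with hh
  set g : ℝ := (y⁻¹ - y) / 2 with hg
  have hyy : y * y⁻¹ = 1 := mul_inv_cancel₀ hy.ne'
  have hgh : h ^ 2 - g ^ 2 = 1 := by linear_combination hyy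
  have hhpos : 0 < h := by positivity
  have hh1 : 1 ≤ h := by nlinarith [sq_nonneg g]
  have hq : 0 < h * r - 1 := by nlinarith
  have hq' := hq.ne'
  set c : ℝ := (r - h) / (h * r - 1) with hc
  set κ : ℝ := s / (h * r - 1) with hκ
  clear_value h g
  have hκpos : 0 < κ := by positivity
  have ec : c * (h * r - 1) = r - h := div_mul_cancel₀ _ hq'
  have eκ : κ * (h * r - 1) = s := div_mul_cancel₀ _ hq'
  clear_value c κ
  have hκc : 1 + r * c = s * κ :=
    mul_right_cancel₀ hq' (by linear_combination r * ec - s * eκ - hs2)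
  have hrc : r + c = s * κ * h :=
    mul_right_cancel₀ hq' (by linear_combination ec - s * h * eκ - h * hs2)
  have hcg : c ^ 2 + (g * κ) ^ 2 = 1 :=
    mul_right_cancel₀ (pow_ne_zero 2 hq') (by
      linear_combination (c * (h * r - 1) + r - h) * ec
        + g ^ 2 * (κ * (h * r - 1) + s) * eκ + g ^ 2 * hs2 - (r ^ 2 - 1) * hgh)
  have hc1 : -1 ≤ c := by nlinarith [sq_nonneg (g * κ)]
  have hc2 : c ≤ 1 := by nlinarith [sq_nonneg (g * κ)]
  have harc : Real.arccos c ≤ t₀ := by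
    rw [ht₀]
    refine Real.arccos_le_arccos ?_
    rw [div_le_iff₀ (by linarith)]
    nlinarith
  have harc0 := Real.arccos_nonneg c
  obtain ⟨t, ht, hcos, hsin⟩ : ∃ t ∈ Set.Icc (-t₀) t₀, Real.cos t = c ∧ Real.sin t = g * κ := by
    have hsq : Real.sqrt (1 - c ^ 2) = |g * κ| := by
      rw [← Real.sqrt_sq_eq_abs]; congr 1; linarith
    obtain hg0 | hg0 := le_total 0 (g * κ)
    · exact ⟨Real.arccos c, ⟨by linarith, harc⟩, Real.cos_arccos hc1 hc2, by
        rw [Real.sin_arccos, hsq, abs_of_nonneg hg0]⟩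
    · exact ⟨-Real.arccos c, ⟨by linarith, by linarith⟩, by
        rw [Real.cos_neg, Real.cos_arccos hc1 hc2], by
        rw [Real.sin_neg, Real.sin_arccos, hsq, abs_of_nonpos hg0, neg_neg]⟩
  refine ⟨t, ht, κ, hκpos, by rw [hcos, hκc], ?_, ?_⟩
  · rw [hcos, hsin, hrc, hh, hg]; field_simp; ring
  · rw [hcos, hsin, hrc, hh, hg]; field_simp; ring

/-- Let `r > 1`, `t₀ = arccos(−1/r)`, and let `H, G ∈ M_n(ℂ)` be Hermitian with
`±√(r²−1)·G ≤ H` and `cos t·(H − rI) + sin t·G ≤ I` for all `t ∈ [−t₀, t₀]`. Then there is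
a Hermitian `P` with `0 ≤ P ≤ I` such that `cos t·H + sin t·G ≤ (1 + r·cos t)·P` for all
`t ∈ [−π, π]`. -/
theorem exists_P_dominating {n : ℕ} (r : ℝ) (hr : 1 < r) (t₀ : ℝ)
    (ht₀ : t₀ = Real.arccos (-1 / r))
    (H G : Matrix (Fin n) (Fin n) ℂ) (hH : H.IsHermitian) (hG : G.IsHermitian)
    (h1 : (H - Real.sqrt (r ^ 2 - 1) • G).PosSemidef)
    (h2 : (H + Real.sqrt (r ^ 2 - 1) • G).PosSemidef)
    (h3 : ∀ t ∈ Set.Icc (-t₀) t₀,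
      ((1 : Matrix (Fin n) (Fin n) ℂ)
        - (Real.cos t • (H - r • (1 : Matrix (Fin n) (Fin n) ℂ)) + Real.sin t • G)).PosSemidef) :
    ∃ P : Matrix (Fin n) (Fin n) ℂ, P.IsHermitian ∧ P.PosSemidef ∧
      ((1 : Matrix (Fin n) (Fin n) ℂ) - P).PosSemidef ∧
      ∀ t ∈ Set.Icc (-Real.pi) Real.pi,
        ((1 + r * Real.cos t) • P - (Real.cos t • H + Real.sin t • G)).PosSemidef := by
  set s : ℝ := Real.sqrt (r ^ 2 - 1)
  have hr2 : 0 < r ^ 2 - 1 := by nlinarith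
  have hs : 0 < s := Real.sqrt_pos.2 hr2
  have hs2 : s ^ 2 = r ^ 2 - 1 := Real.sq_sqrt hr2.le
  set A : Matrix (Fin n) (Fin n) ℂ := (1 / (2 * s)) • (H + s • G) with hA_def
  set B : Matrix (Fin n) (Fin n) ℂ := (1 / (2 * s)) • (H - s • G) with hB_def
  have hA : A.PosSemidef := h2.smul (by positivity)
  have hB : B.PosSemidef := h1.smul (by positivity)
  have hAB : H = s • (A + B) := by
    rw [hA_def, hB_def]
    match_scalars <;> field_simp <;> norm_num
  have hAB' : G = A - B := by
    rw [hA_def, hB_def]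
    match_scalars <;> field_simp <;> norm_num
  clear_value A B
  subst hAB hAB'
  have hkey : ∀ (t : ℝ) (K : Matrix (Fin n) (Fin n) ℂ),
      (1 + r * Real.cos t) • ((1 / s) • (K + r • (A + B)))
          - (Real.cos t • (s • (A + B)) + Real.sin t • (A - B))
        = ((r + Real.cos t) / s - Real.sin t) • A + ((1 + r * Real.cos t) / s) • K
          + ((r + Real.cos t) / s + Real.sin t) • B := by
    intro t K
    match_scalars
    · field_simp
    · field_simp; linear_combination -Real.cos t * hs2
    · field_simp; linear_combination -Real.cos t * hs2
  have hL : (s • (1 : Matrix (Fin n) (Fin n) ℂ) - r • (A + B)).IsHermitian :=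
    (PosSemidef.one.smul hs.le).isHermitian.sub
      ((hA.add hB).smul (by positivity : 0 ≤ r)).isHermitian
  obtain ⟨K, hK, hKL⟩ := exists_mem_pencilSet hA hB hL (by
    intro y hy
    obtain ⟨t, ht, κ, hκ, e1, e2, e3⟩ := exists_trig_parameter hr ht₀ hs hs2 hy
    have := hkey t (s • (1 : Matrix (Fin n) (Fin n) ℂ) - r • (A + B))
    rw [sub_add_cancel, smul_smul (1 / s) s, one_div_mul_cancel hs.ne', one_smul, e2, e3, e1,
      mul_div_cancel_left₀ _ hs.ne'] at this
    convert ((h3 t ht).smul (div_nonneg hy.le hκ.le)) using 1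
    have h4 : (1 : Matrix (Fin n) (Fin n) ℂ) - (Real.cos t • (s • (A + B)
        - r • (1 : Matrix (Fin n) (Fin n) ℂ)) + Real.sin t • (A - B))
        = (s * κ) • (1 : Matrix (Fin n) (Fin n) ℂ)
          - (Real.cos t • (s • (A + B)) + Real.sin t • (A - B)) := by
      rw [← e1]; module
    rw [h4, this]
    match_scalars <;> field_simp)
  have hP : ((1 / s) • (K + r • (A + B))).PosSemidef := by
    refine PosSemidef.smul ?_ (by positivity)
    convert (add_add_posSemidef_of_mem_pencilSet hK).add
      ((hA.add hB).smul (sub_nonneg.2 hr.le)) using 1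
    module
  refine ⟨(1 / s) • (K + r • (A + B)), hP.isHermitian, hP, ?_, fun t _ => ?_⟩
  · convert hKL.smul (one_div_pos.2 hs).le using 1
    match_scalars <;> field_simp
  · rw [hkey]
    have hpos : 0 < r + Real.cos t := by linarith [Real.neg_one_le_cos t]
    have hmul : ((1 + r * Real.cos t) / s) ^ 2
        = ((r + Real.cos t) / s - Real.sin t) * ((r + Real.cos t) / s + Real.sin t) := by
      field_simp
      linear_combination Real.sin t ^ 2 * hs2 + (r ^ 2 - 1) * Real.sin_sq_add_cos_sq t
    have hsum : 0 < (r + Real.cos t) / s := by positivity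
    have hprod := hmul ▸ sq_nonneg ((1 + r * Real.cos t) / s)
    refine posSemidef_of_mem_pencilSet hA hK ?_ ?_ hmul
    · by_contra! hneg
      nlinarith
    · by_contra! hneg
      nlinarith
end

section
/- Let r ∈ ℝ and let H, G, P ∈ M_n(ℂ) be Hermitian matrices with 0 ≤ P ≤ I. Then the following are equivalent: (1) for all a₁, a₂, a₃ ≥ 0 and all c ∈ ℝ with c² ≤ a₁·a₂, the matrix a₁·(P+G)/2 + a₂·(P−G)/2 + c·(H − r·P) + a₃·(I − P) is positive semidefinite (i.e., the linear map Ψ on span{E₁₁, E₂₂, E₃₃, E₁₂+E₂₁} ⊆ M₃(ℂ) with Ψ(E₁₁+E₂₂) = P, Ψ(E₁₁−E₂₂) = G, Ψ(E₁₂+E₂₁) = H − rP, Ψ(E₃₃) = I − P is positive); (2) cos t · (H − r·P) + sin t · G ≤ P for all t ∈ [−π, π]. -/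
open Matrix
open scoped ComplexOrder

/-- Let `r ∈ ℝ` and let `H, G, P ∈ M_n(ℂ)` be Hermitian with `0 ≤ P ≤ I`. The following
are equivalent:
(1) for all `a₁, a₂, a₃ ≥ 0` and `c ∈ ℝ` with `c² ≤ a₁a₂`, the matrix
`a₁(P+G)/2 + a₂(P−G)/2 + c(H − rP) + a₃(I − P)` is positive semidefinite (positivity of
the map `Ψ` on `span{E₁₁, E₂₂, E₃₃, E₁₂+E₂₁} ⊆ M₃(ℂ)` with `Ψ(E₁₁+E₂₂) = P`,
`Ψ(E₁₁−E₂₂) = G`, `Ψ(E₁₂+E₂₁) = H − rP`, `Ψ(E₃₃) = I − P`);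
(2) `cos t·(H − rP) + sin t·G ≤ P` for all `t ∈ [−π, π]`. -/
theorem psi_positive_iff_cos_sin_bound {n : ℕ} (r : ℝ)
    (H G P : Matrix (Fin n) (Fin n) ℂ)
    (hH : H.IsHermitian) (hG : G.IsHermitian) (hP : P.PosSemidef)
    (hP1 : ((1 : Matrix (Fin n) (Fin n) ℂ) - P).PosSemidef) :
    (∀ a₁ a₂ a₃ : ℝ, 0 ≤ a₁ → 0 ≤ a₂ → 0 ≤ a₃ → ∀ c : ℝ, c ^ 2 ≤ a₁ * a₂ →
        ((a₁ / 2) • (P + G) + (a₂ / 2) • (P - G) + c • (H - r • P)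
          + a₃ • ((1 : Matrix (Fin n) (Fin n) ℂ) - P)).PosSemidef)
      ↔
      ∀ t ∈ Set.Icc (-Real.pi) Real.pi,
        (P - (Real.cos t • (H - r • P) + Real.sin t • G)).PosSemidef := by
  generalize H - r • P = X
  constructor
  · intro h t _
    have hsin := Real.neg_one_le_sin t
    have hsin' := Real.sin_le_one t
    have key := h (1 - Real.sin t) (1 + Real.sin t) 0 (by linarith) (by linarith) le_rfl
      (-Real.cos t) (by nlinarith [Real.sin_sq_add_cos_sq t])
    convert key using 1
    module
  · intro h a₁ a₂ a₃ ha₁ ha₂ ha₃ c hc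
    obtain ⟨ρ, t, ht, hρ, hcos, hsin⟩ : ∃ ρ t : ℝ, t ∈ Set.Icc (-Real.pi) Real.pi ∧ 0 ≤ ρ ∧
        ρ * Real.cos t = -c ∧ ρ * Real.sin t = (a₂ - a₁) / 2 := by
      refine ⟨‖(⟨-c, (a₂ - a₁) / 2⟩ : ℂ)‖, Complex.arg ⟨-c, (a₂ - a₁) / 2⟩,
        ⟨(Complex.neg_pi_lt_arg _).le, Complex.arg_le_pi _⟩, norm_nonneg _, ?_, ?_⟩
      · rw [Complex.norm_mul_cos_arg]
      · rw [Complex.norm_mul_sin_arg]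
    have hle : ρ ≤ (a₁ + a₂) / 2 := by
      refine le_of_sq_le_sq ?_ (by positivity)
      have : ρ ^ 2 = (ρ * Real.cos t) ^ 2 + (ρ * Real.sin t) ^ 2 := by
        rw [mul_pow, mul_pow, ← mul_add, Real.cos_sq_add_sin_sq, mul_one]
      rw [this, hcos, hsin]
      nlinarith
    have key := (((h t ht).smul hρ).add (hP.smul (sub_nonneg.2 hle))).add (hP1.smul ha₃)
    convert key using 1
    obtain rfl : c = -(ρ * Real.cos t) := by linarith
    obtain rfl : a₂ = a₁ + 2 * (ρ * Real.sin t) := by linarith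
    module
end
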